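/- Under the assumptions ‖U_t‖ ≤ 3‖U♮‖, σ_min(U_tW_t) ≥ σ_min(U♮)/√10, and ‖V_{X♮⊥}ᵀV_{U_tW_t}‖ ≤ c·κ_f^{-2} for a sufficiently small constant c > 0, the spectral-norm bound ‖X♮ − U_tU_tᵀ‖ ≤ 4·‖V_{X♮}ᵀ(X♮ − U_tU_tᵀ)‖ + ‖U_tW_{t,⊥}W_{t,⊥}ᵀU_tᵀ‖ holds. -/

import Mathlib

open scoped BigOperators
open Matrix MeasureTheory ProbabilityTheory

noncomputable section

/-- Euclidean (ℓ²) norm of a vector in `ℝ^n`. -/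
def vecNorm {n : ℕ} (v : Fin n → ℝ) : ℝ := Real.sqrt (∑ i, (v i) ^ 2)

/-- Frobenius norm of a matrix. -/
def frobNorm {m n : ℕ} (A : Matrix (Fin m) (Fin n) ℝ) : ℝ :=
  Real.sqrt (∑ i, ∑ j, (A i j) ^ 2)

/-- The `k`-th largest singular value of a matrix, via the Courant–Fischer
min-max characterization. -/
def singVal {m n : ℕ} (A : Matrix (Fin m) (Fin n) ℝ) (k : ℕ) : ℝ :=
  sSup {c : ℝ | 0 ≤ c ∧ ∃ V : Submodule ℝ (Fin n → ℝ),
    Module.finrank ℝ V = k ∧ ∀ x ∈ V, c * vecNorm x ≤ vecNorm (A.mulVec x)}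

/-- Spectral (operator) norm: the largest singular value. -/
def specNorm {m n : ℕ} (A : Matrix (Fin m) (Fin n) ℝ) : ℝ := singVal A 1

/-- Nuclear norm: the sum of all singular values. -/
def nucNorm {m n : ℕ} (A : Matrix (Fin m) (Fin n) ℝ) : ℝ :=
  ∑ k ∈ Finset.Icc 1 (min m n), singVal A k

open scoped Matrix.Norms.L2Operator

lemma vecNorm_eq_norm {n : ℕ} (v : Fin n → ℝ) : vecNorm v = ‖WithLp.toLp 2 v‖ := by
  simp [vecNorm, EuclideanSpace.norm_eq]

lemma vecNorm_nonneg {n : ℕ} (v : Fin n → ℝ) : 0 ≤ vecNorm v := Real.sqrt_nonneg _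

lemma vecNorm_pos {n : ℕ} {v : Fin n → ℝ} (hv : v ≠ 0) : 0 < vecNorm v := by
  simpa [vecNorm_eq_norm] using hv

lemma vecNorm_smul {n : ℕ} (a : ℝ) (v : Fin n → ℝ) : vecNorm (a • v) = |a| * vecNorm v := by
  simp [vecNorm_eq_norm, norm_smul]

lemma vecNorm_sq {n : ℕ} (v : Fin n → ℝ) : vecNorm v ^ 2 = v ⬝ᵥ v := by
  rw [vecNorm, Real.sq_sqrt (Finset.sum_nonneg fun i _ => sq_nonneg _)]
  simp [dotProduct, sq]

lemma vecNorm_mulVec_sq {m n : ℕ} (A : Matrix (Fin m) (Fin n) ℝ) (v : Fin n → ℝ) :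
    vecNorm (A *ᵥ v) ^ 2 = v ⬝ᵥ ((Aᵀ * A) *ᵥ v) := by
  rw [vecNorm_sq, ← mulVec_mulVec, dotProduct_mulVec v, vecMul_transpose]

lemma vecNorm_mulVec_le {m n : ℕ} (A : Matrix (Fin m) (Fin n) ℝ) (v : Fin n → ℝ) :
    vecNorm (A *ᵥ v) ≤ ‖A‖ * vecNorm v := by
  rw [vecNorm_eq_norm, vecNorm_eq_norm]
  exact A.l2_opNorm_mulVec (WithLp.toLp 2 v)

lemma l2_opNorm_le_of_vecNorm {m n : ℕ} {A : Matrix (Fin m) (Fin n) ℝ} {C : ℝ} (hC : 0 ≤ C)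
    (h : ∀ v, vecNorm (A *ᵥ v) ≤ C * vecNorm v) : ‖A‖ ≤ C := by
  rw [l2_opNorm_def]
  refine ContinuousLinearMap.opNorm_le_bound _ hC fun x => ?_
  have hx := h x.ofLp
  rw [vecNorm_eq_norm, vecNorm_eq_norm] at hx
  exact hx

lemma le_l2_opNorm_of_finrank_pos {m n : ℕ} {A : Matrix (Fin m) (Fin n) ℝ} {c : ℝ}
    {V : Submodule ℝ (Fin n → ℝ)} (hV : 0 < Module.finrank ℝ V)
    (h : ∀ x ∈ V, c * vecNorm x ≤ vecNorm (A *ᵥ x)) : c ≤ ‖A‖ := by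
  have hne : V ≠ ⊥ := by
    rintro rfl
    simp at hV
  obtain ⟨x, hx, hx0⟩ := V.exists_mem_ne_zero_of_ne_bot hne
  exact le_of_mul_le_mul_right ((h x hx).trans (vecNorm_mulVec_le A x)) (vecNorm_pos hx0)

lemma singVal_le_l2_opNorm {m n : ℕ} (A : Matrix (Fin m) (Fin n) ℝ) (k : ℕ) :
    singVal A k ≤ ‖A‖ := by
  rcases Nat.eq_zero_or_pos k with rfl | hk
  · have hset : ¬ BddAbove {c : ℝ | 0 ≤ c ∧ ∃ V : Submodule ℝ (Fin n → ℝ),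
        Module.finrank ℝ V = 0 ∧ ∀ x ∈ V, c * vecNorm x ≤ vecNorm (A.mulVec x)} := by
      rintro ⟨b, hb⟩
      have hmem := @hb (|b| + 1) ⟨by positivity, ⊥, by simp, by
        intro x hx
        rw [(Submodule.mem_bot ℝ).mp hx]
        simp [vecNorm]⟩
      linarith [le_abs_self b]
    rw [singVal, Real.sSup_of_not_bddAbove hset]
    exact norm_nonneg A
  · refine Real.sSup_le ?_ (norm_nonneg A)
    rintro c ⟨-, V, hV, h⟩
    exact le_l2_opNorm_of_finrank_pos (hV ▸ hk) h

lemma specNorm_eq_l2_opNorm {m n : ℕ} (A : Matrix (Fin m) (Fin n) ℝ) : specNorm A = ‖A‖ := by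
  refine le_antisymm (singVal_le_l2_opNorm A 1) ?_
  refine l2_opNorm_le_of_vecNorm (Real.sSup_nonneg fun c hc => hc.1) fun v => ?_
  rcases eq_or_ne v 0 with rfl | hv
  · simp [vecNorm]
  have hpos := vecNorm_pos hv
  rw [← div_le_iff₀ hpos]
  refine le_csSup ⟨‖A‖, ?_⟩ ⟨div_nonneg (vecNorm_nonneg _) hpos.le, ℝ ∙ v,
    finrank_span_singleton hv, ?_⟩
  · rintro c ⟨-, V, hV, h⟩
    exact le_l2_opNorm_of_finrank_pos (by simp [hV]) h
  · intro x hx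
    obtain ⟨a, rfl⟩ := Submodule.mem_span_singleton.mp hx
    rw [mulVec_smul, vecNorm_smul, vecNorm_smul]
    apply le_of_eq
    field_simp

lemma l2_opNorm_transpose {m n : ℕ} (A : Matrix (Fin m) (Fin n) ℝ) : ‖Aᵀ‖ = ‖A‖ := by
  simpa [conjTranspose_eq_transpose_of_trivial] using l2_opNorm_conjTranspose A

lemma l2_opNorm_le_one_of_orthonormal {m n : ℕ} {A : Matrix (Fin m) (Fin n) ℝ}
    (hA : Aᵀ * A = 1) : ‖A‖ ≤ 1 := by
  refine l2_opNorm_le_of_vecNorm zero_le_one fun v => ?_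
  rw [one_mul, ← sq_le_sq₀ (vecNorm_nonneg _) (vecNorm_nonneg _), vecNorm_mulVec_sq, hA,
    one_mulVec, vecNorm_sq]

lemma l2_opNorm_mul_mul_le {k l m n : ℕ} {A : Matrix (Fin k) (Fin l) ℝ}
    {C : Matrix (Fin m) (Fin n) ℝ} (hA : ‖A‖ ≤ 1) (hC : ‖C‖ ≤ 1)
    (B : Matrix (Fin l) (Fin m) ℝ) : ‖A * B * C‖ ≤ ‖B‖ := by
  have h1 := l2_opNorm_mul (A * B) C
  have h2 := l2_opNorm_mul A B
  nlinarith [norm_nonneg A, norm_nonneg B, norm_nonneg C, norm_nonneg (A * B),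
    mul_le_mul_of_nonneg_right hA (norm_nonneg B),
    mul_le_mul_of_nonneg_left hC (norm_nonneg (A * B))]

/-- A condition number defined as a ratio of singular values satisfies `κ⁻² ≤ 1`, including in the
degenerate cases where the ratio is `0`. -/
lemma inv_sq_specNorm_div_singVal_le_one {m n : ℕ} (A : Matrix (Fin m) (Fin n) ℝ) (k : ℕ) :
    ((specNorm A / singVal A k) ^ 2)⁻¹ ≤ 1 := by
  have h0 : 0 ≤ singVal A k := Real.sSup_nonneg fun c hc => hc.1
  have h1 : singVal A k ≤ specNorm A := by
    rw [specNorm_eq_l2_opNorm]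
    exact singVal_le_l2_opNorm A k
  rcases h0.eq_or_lt with h | h
  · simp [← h]
  · exact inv_le_one_of_one_le₀ (one_le_pow₀ ((one_le_div h).mpr h1))

/-- If the column space of `Y`, spanned by `V`, is nearly orthogonal to that of `N`, then the
component of `Y w` along `N` is dominated by the complementary one along `P`. -/
lemma vecNorm_perp_le {n p q k l : ℕ} {P : Matrix (Fin n) (Fin p) ℝ}
    {N : Matrix (Fin n) (Fin q) ℝ} {V : Matrix (Fin n) (Fin k) ℝ}
    {Y : Matrix (Fin n) (Fin l) ℝ} (hPN : P * Pᵀ + N * Nᵀ = 1) (hV : Vᵀ * V = 1)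
    (hVY : V * Vᵀ * Y = Y) (hNV : ‖Nᵀ * V‖ ≤ 1 / 2) (w : Fin l → ℝ) :
    vecNorm ((Nᵀ * Y) *ᵥ w) ≤ vecNorm ((Pᵀ * Y) *ᵥ w) := by
  set z := (Vᵀ * Y) *ᵥ w with hz
  have hN : (Nᵀ * Y) *ᵥ w = (Nᵀ * V) *ᵥ z := by
    rw [hz, mulVec_mulVec, Matrix.mul_assoc, ← Matrix.mul_assoc V, hVY]
  have hP : (Pᵀ * Y) *ᵥ w = (Pᵀ * V) *ᵥ z := by
    rw [hz, mulVec_mulVec, Matrix.mul_assoc, ← Matrix.mul_assoc V, hVY]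
  have hpyth : vecNorm ((Pᵀ * V) *ᵥ z) ^ 2 + vecNorm ((Nᵀ * V) *ᵥ z) ^ 2 = vecNorm z ^ 2 := by
    have hsum : (Pᵀ * V)ᵀ * (Pᵀ * V) + (Nᵀ * V)ᵀ * (Nᵀ * V) = 1 := by
      calc _ = Vᵀ * (P * Pᵀ + N * Nᵀ) * V := by
            simp only [transpose_mul, transpose_transpose, Matrix.mul_add, Matrix.add_mul,
              Matrix.mul_assoc]
        _ = 1 := by rw [hPN, Matrix.mul_one, hV]
    rw [vecNorm_mulVec_sq, vecNorm_mulVec_sq, ← dotProduct_add, ← add_mulVec, hsum, one_mulVec,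
      vecNorm_sq]
  have hle := vecNorm_mulVec_le (Nᵀ * V) z
  rw [hN, hP, ← sq_le_sq₀ (vecNorm_nonneg _) (vecNorm_nonneg _)]
  have h2 : vecNorm ((Nᵀ * V) *ᵥ z) ≤ 1 / 2 * vecNorm z :=
    hle.trans (mul_le_mul_of_nonneg_right hNV (vecNorm_nonneg z))
  nlinarith [vecNorm_nonneg ((Nᵀ * V) *ᵥ z), vecNorm_nonneg z]

/-- `‖X♮ − U_tU_tᵀ‖ ≤ 4‖V_{X♮}ᵀ(X♮ − U_tU_tᵀ)‖ + ‖U_tW_{t,⊥}W_{t,⊥}ᵀU_tᵀ‖`. -/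
theorem lemma_error_bound_two :
    ∃ c : ℝ, 0 < c ∧
      ∀ (n r rstar : ℕ)
        (Unat : Matrix (Fin n) (Fin rstar) ℝ) (Xnat : Matrix (Fin n) (Fin n) ℝ),
        Xnat = Unat * Unatᵀ → Xnat.rank = rstar →
        ∀ (kappaf : ℝ), kappaf = specNorm Unat / singVal Unat rstar →
        ∀ (Ut : Matrix (Fin n) (Fin r) ℝ)
          (VX : Matrix (Fin n) (Fin rstar) ℝ)
          (VXperp : Matrix (Fin n) (Fin (n - rstar)) ℝ)
          (W : Matrix (Fin r) (Fin rstar) ℝ)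
          (Wperp : Matrix (Fin r) (Fin (r - rstar)) ℝ)
          (VUW : Matrix (Fin n) (Fin rstar) ℝ),
        -- V_{X♮} is an orthonormal basis of the column space of X♮,
        -- V_{X♮⊥} of its orthogonal complement
        VXᵀ * VX = 1 → VX * VXᵀ * Xnat = Xnat →
        VXperpᵀ * VXperp = 1 → VX * VXᵀ + VXperp * VXperpᵀ = 1 →
        -- W_t comes from the SVD of V_{X♮}ᵀ U_t, and W_{t,⊥} is an orthonormal
        -- complement of W_t
        Wᵀ * W = 1 → VXᵀ * Ut * (W * Wᵀ) = VXᵀ * Ut →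
        Wperpᵀ * Wperp = 1 → Wᵀ * Wperp = 0 → W * Wᵀ + Wperp * Wperpᵀ = 1 →
        -- V_{U_tW_t} is an orthonormal basis of the column space of U_tW_t
        VUWᵀ * VUW = 1 → VUW * VUWᵀ * (Ut * W) = Ut * W →
        -- assumptions
        specNorm Ut ≤ 3 * specNorm Unat →
        singVal Unat rstar / Real.sqrt 10 ≤ singVal (Ut * W) rstar →
        specNorm (VXperpᵀ * VUW) ≤ c * (kappaf ^ 2)⁻¹ →
        specNorm (Xnat - Ut * Utᵀ) ≤
          4 * specNorm (VXᵀ * (Xnat - Ut * Utᵀ)) + specNorm (Ut * Wperp * Wperpᵀ * Utᵀ) := by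
  refine ⟨1 / 2, by norm_num, ?_⟩
  intro n r rstar Unat Xnat hX _ kappaf hkappa Ut P N W W' V hP hPX hN hPN _ hW _ _ hWW hV hVY
    _ _ hNV
  simp only [specNorm_eq_l2_opNorm (m := n), specNorm_eq_l2_opNorm (m := rstar)]
  have hNV' : ‖Nᵀ * V‖ ≤ 1 / 2 := by
    have hk := inv_sq_specNorm_div_singVal_le_one Unat rstar
    rw [← hkappa] at hk
    rw [← specNorm_eq_l2_opNorm]
    linarith
  set D := Xnat - Ut * Utᵀ with hD
  have hXt : Xnatᵀ = Xnat := by rw [hX, transpose_mul, transpose_transpose]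
  have hDt : Dᵀ = D := by
    rw [hD, transpose_sub, hXt, transpose_mul, transpose_transpose]
  have hXP : Xnat * (P * Pᵀ) = Xnat := by
    simpa [hXt, Matrix.mul_assoc] using congrArg transpose hPX
  have hPPN : P * Pᵀ * N = 0 := by
    have h := congrArg (· * N) hPN
    simpa [Matrix.add_mul, Matrix.mul_assoc, hN] using h
  have hXN : Xnat * N = 0 := by
    rw [← hXP, Matrix.mul_assoc, hPPN, Matrix.mul_zero]
  have hP1 := l2_opNorm_le_one_of_orthonormal hP
  have hN1 := l2_opNorm_le_one_of_orthonormal hN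
  have hNt1 : ‖Nᵀ‖ ≤ 1 := (l2_opNorm_transpose N).trans_le hN1
  have hPt1 : ‖Pᵀ‖ ≤ 1 := (l2_opNorm_transpose P).trans_le hP1
  have hone : ‖(1 : Matrix (Fin n) (Fin n) ℝ)‖ ≤ 1 :=
    l2_opNorm_le_one_of_orthonormal (by simp)
  have hNN1 : ‖N * Nᵀ‖ ≤ 1 :=
    (l2_opNorm_mul N Nᵀ).trans (mul_le_one₀ hN1 (norm_nonneg _) hNt1)
  have hPU : Pᵀ * (Ut * W) * (Ut * W)ᵀ = Pᵀ * Ut * Utᵀ := by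
    calc _ = Pᵀ * Ut * (W * Wᵀ) * Utᵀ := by simp only [transpose_mul, Matrix.mul_assoc]
      _ = _ := by rw [hW]
  have hsplit : D = P * (Pᵀ * D) * 1 + N * Nᵀ * (D * P) * Pᵀ
      + (-(N * (Nᵀ * (Ut * W) * (Ut * W)ᵀ * N) * Nᵀ)
        + -(N * Nᵀ * (Ut * W' * W'ᵀ * Utᵀ) * (N * Nᵀ))) := by
    have hNDN : -(N * (Nᵀ * (Ut * W) * (Ut * W)ᵀ * N) * Nᵀ)
        + -(N * Nᵀ * (Ut * W' * W'ᵀ * Utᵀ) * (N * Nᵀ)) = N * Nᵀ * D * (N * Nᵀ) := by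
      calc _ = -(N * Nᵀ * (Ut * (W * Wᵀ + W' * W'ᵀ) * Utᵀ) * (N * Nᵀ)) := by
            simp only [transpose_mul, Matrix.mul_add, Matrix.add_mul, Matrix.mul_assoc, neg_add]
        _ = N * Nᵀ * (Xnat * N) * Nᵀ - N * Nᵀ * (Ut * Utᵀ) * (N * Nᵀ) := by
            rw [hWW, hXN]; simp
        _ = _ := by
            rw [hD]
            simp only [Matrix.mul_sub, Matrix.sub_mul, Matrix.mul_assoc]
    rw [hNDN]
    calc D = (P * Pᵀ + N * Nᵀ) * D := by rw [hPN, Matrix.one_mul]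
      _ = P * Pᵀ * D + N * Nᵀ * D * (P * Pᵀ + N * Nᵀ) := by
          rw [Matrix.add_mul, hPN, Matrix.mul_one]
      _ = _ := by
          simp only [Matrix.mul_add, Matrix.mul_assoc, Matrix.mul_one, add_assoc]
  have h1 : ‖P * (Pᵀ * D) * 1‖ ≤ ‖Pᵀ * D‖ := l2_opNorm_mul_mul_le hP1 hone _
  have h2 : ‖N * Nᵀ * (D * P) * Pᵀ‖ ≤ ‖Pᵀ * D‖ := by
    refine (l2_opNorm_mul_mul_le hNN1 hPt1 _).trans_eq ?_
    rw [← l2_opNorm_transpose, transpose_mul, hDt]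
  have h3 : ‖N * (Nᵀ * (Ut * W) * (Ut * W)ᵀ * N) * Nᵀ‖ ≤ ‖Pᵀ * D‖ := by
    refine (l2_opNorm_mul_mul_le hN1 hNt1 _).trans ?_
    refine l2_opNorm_le_of_vecNorm (norm_nonneg _) fun x => ?_
    have hx := vecNorm_perp_le hPN hV hVY hNV' (((Ut * W)ᵀ * N) *ᵥ x)
    have hPD : Pᵀ * (Ut * W) * ((Ut * W)ᵀ * N) = -(Pᵀ * D * N) := by
      rw [← Matrix.mul_assoc, hPU, hD]
      simp [Matrix.mul_sub, Matrix.sub_mul, Matrix.mul_assoc, hXN]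
    rw [mulVec_mulVec, mulVec_mulVec, hPD, ← Matrix.mul_assoc] at hx
    refine hx.trans ((vecNorm_mulVec_le _ x).trans ?_)
    refine mul_le_mul_of_nonneg_right ?_ (vecNorm_nonneg x)
    rw [norm_neg]
    exact (l2_opNorm_mul _ _).trans (mul_le_of_le_one_right (norm_nonneg _) hN1)
  have h4 : ‖N * Nᵀ * (Ut * W' * W'ᵀ * Utᵀ) * (N * Nᵀ)‖ ≤ ‖Ut * W' * W'ᵀ * Utᵀ‖ :=
    l2_opNorm_mul_mul_le hNN1 hNN1 _
  have hsum : ‖D‖ ≤ ‖P * (Pᵀ * D) * 1‖ + ‖N * Nᵀ * (D * P) * Pᵀ‖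
      + (‖N * (Nᵀ * (Ut * W) * (Ut * W)ᵀ * N) * Nᵀ‖
        + ‖N * Nᵀ * (Ut * W' * W'ᵀ * Utᵀ) * (N * Nᵀ)‖) := by
    conv_lhs => rw [hsplit]
    refine (norm_add_le _ _).trans (add_le_add (norm_add_le _ _) ((norm_add_le _ _).trans_eq ?_))
    rw [norm_neg, norm_neg]
  linarith [norm_nonneg (Pᵀ * D)]
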